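/- For every integer r ≥ 1 there exists a unique sequence of Laurent polynomials (b_i^{(r)}(q))_{i=0}^∞ in q with nonnegative integer coefficients such that for every integer n ≥ 0, ∑_{k=0}^n q^{−rkn} · [n choose k]_q^r · [n+k choose k]_q^r = ∑_{i=0}^n q^{−ni} · [n choose i]_q · [n+i choose i]_q · b_i^{(r)}(q); moreover b_i^{(r)}(q) = ∑_{k=0}^i P_{k,i}^{(r)}(q), with the convention P_{k,i}^{(r)}(q) = 0 for i > kr. -/

import Mathlib

open Polynomial LaurentPolynomial Finset

/-- The Gaussian (q-)binomial coefficient `[n choose k]_q` as a polynomial in `q`,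
defined by the q-Pascal recursion; it equals `(q)_n / ((q)_k (q)_{n-k})` for `0 ≤ k ≤ n`
and vanishes for `k > n`. -/
noncomputable def qbinom : ℕ → ℕ → Polynomial ℤ
  | _, 0 => 1
  | 0, _ + 1 => 0
  | n + 1, k + 1 => qbinom n k + Polynomial.X ^ (k + 1) * qbinom n (k + 1)

/-- `[n choose k]_q` viewed as a Laurent polynomial. -/
noncomputable def qb (n k : ℕ) : LaurentPolynomial ℤ := (qbinom n k).toLaurent

theorem eval_one_qbinom (n k : ℕ) : (qbinom n k).eval 1 = n.choose k := by
  induction n generalizing k with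
  | zero => cases k <;> simp [qbinom]
  | succ n ih => cases k <;> simp [qbinom, ih, Nat.choose_succ_succ]

theorem qb_ne_zero {n k : ℕ} (h : k ≤ n) : qb n k ≠ 0 := by
  intro h0
  have h1 : qbinom n k = 0 := Polynomial.toLaurent_injective (by simpa [qb] using h0)
  have h2 := eval_one_qbinom n k
  rw [h1, Polynomial.eval_zero] at h2
  exact (Nat.choose_pos h).ne' (by exact_mod_cast h2.symm)

/-- A triangular system with nonzero diagonal entries has at most one solution. -/
theorem eq_of_triangular_sum_eq {R : Type*} [CommRing R] [IsDomain R] (A : ℕ → ℕ → R)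
    (hA : ∀ n, A n n ≠ 0) {b c : ℕ → R}
    (h : ∀ n, ∑ i ∈ range (n + 1), A n i * b i = ∑ i ∈ range (n + 1), A n i * c i) (n : ℕ) :
    b n = c n := by
  induction n using Nat.strong_induction_on with
  | _ n ih =>
    have hn := h n
    rw [sum_range_succ, sum_range_succ,
      sum_congr rfl fun i hi => by rw [ih i (mem_range.mp hi)]] at hn
    exact mul_left_cancel₀ (hA n) (add_left_cancel hn)

theorem LaurentPolynomial.coeff_sum_nonneg {ι : Type*} (s : Finset ι)
    (f : ι → LaurentPolynomial ℤ) (m : ℤ) (h : ∀ i ∈ s, 0 ≤ (f i).coeff m) :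
    0 ≤ (∑ i ∈ s, f i).coeff m := by
  simpa [AddMonoidAlgebra.coeff_sum, Finsupp.finsetSum_apply] using sum_nonneg h

theorem sum_qb_pow_eq_of_expansion (P : ℕ → ℕ → LaurentPolynomial ℤ) (r : ℕ)
    (hPsupp : ∀ k i : ℕ, i < k ∨ r * k < i → P k i = 0)
    (hPid : ∀ k n : ℕ, k ≤ n →
      qb n k ^ r * qb (n + k) k ^ r
        = ∑ i ∈ Icc k (min n (r * k)),
            T (((r : ℤ) * k - i) * n) * qb n i * qb (n + i) i * P k i) (n : ℕ) :
    ∑ k ∈ range (n + 1), T (-((r : ℤ) * k * n)) * qb n k ^ r * qb (n + k) k ^ r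
      = ∑ i ∈ range (n + 1),
          T (-((n : ℤ) * i)) * qb n i * qb (n + i) i * ∑ k ∈ range (i + 1), P k i := by
  have hrow : ∀ k ∈ range (n + 1),
      T (-((r : ℤ) * k * n)) * qb n k ^ r * qb (n + k) k ^ r
        = ∑ i ∈ range (n + 1), T (-((n : ℤ) * i)) * qb n i * qb (n + i) i * P k i := by
    intro k hk
    have hsub : Icc k (min n (r * k)) ⊆ range (n + 1) := by
      intro i hi
      simp only [mem_Icc, le_min_iff, mem_range] at hi ⊢
      omega
    rw [mul_assoc, hPid k n (Nat.lt_succ_iff.mp (mem_range.mp hk)), mul_sum,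
      ← sum_subset hsub]
    · refine sum_congr rfl fun i _ => ?_
      have hT : (T (-((n : ℤ) * i)) : LaurentPolynomial ℤ)
          = T (-((r : ℤ) * k * n)) * T (((r : ℤ) * k - i) * n) := by
        rw [← T_add]
        congr 1
        ring
      rw [hT]
      ring
    · intro i hi hni
      rw [hPsupp k i, mul_zero]
      simp only [mem_Icc, le_min_iff, mem_range] at hi hni
      by_contra! hc
      exact hni ⟨hc.1, by omega, hc.2⟩
  rw [sum_congr rfl hrow, sum_comm]
  refine sum_congr rfl fun i hi => ?_
  rw [← mul_sum]
  congr 1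
  symm
  refine sum_subset (range_mono (by simpa using hi)) fun k _ hk => hPsupp k i (Or.inl ?_)
  simp only [mem_range] at hk
  omega

/-- **Theorem 1.3.** For every `r ≥ 1` there is a unique sequence of Laurent polynomials
`b_i^{(r)}(q)` with nonnegative integer coefficients such that for all `n ≥ 0`:
`∑_{k=0}^n q^{-rkn} [n,k]_q^r [n+k,k]_q^r = ∑_{i=0}^n q^{-ni} [n,i]_q [n+i,i]_q b_i^{(r)}(q)`;
moreover `b_i^{(r)}(q) = ∑_{k=0}^i P_{k,i}^{(r)}(q)`, where `P r k i` denotes the Laurent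
polynomial `P_{k,i}^{(r)}(q)` of Lemma 1.2 (with `P_{k,i}^{(r)} = 0` for `i > kr`),
characterized by the hypotheses. -/
theorem qSchmidt_b
    (P : ℕ → ℕ → ℕ → LaurentPolynomial ℤ)
    (hPsupp : ∀ r k i : ℕ, i < k ∨ r * k < i → P r k i = 0)
    (hPnonneg : ∀ r k i : ℕ, ∀ m : ℤ, 0 ≤ (P r k i).coeff m)
    (hPid : ∀ r : ℕ, 1 ≤ r → ∀ k n : ℕ, k ≤ n →
      qb n k ^ r * qb (n + k) k ^ r
        = ∑ i ∈ Icc k (min n (r * k)),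
            T (((r : ℤ) * k - i) * n) * qb n i * qb (n + i) i * P r k i)
    (r : ℕ) (hr : 1 ≤ r) :
    (∃! b : ℕ → LaurentPolynomial ℤ,
      (∀ i : ℕ, ∀ m : ℤ, 0 ≤ (b i).coeff m) ∧
      ∀ n : ℕ,
        ∑ k ∈ range (n + 1),
          T (-((r : ℤ) * k * n)) * qb n k ^ r * qb (n + k) k ^ r
        = ∑ i ∈ range (n + 1),
          T (-((n : ℤ) * i)) * qb n i * qb (n + i) i * b i) ∧
    ∀ b : ℕ → LaurentPolynomial ℤ,
      ((∀ i : ℕ, ∀ m : ℤ, 0 ≤ (b i).coeff m) ∧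
        ∀ n : ℕ,
          ∑ k ∈ range (n + 1),
            T (-((r : ℤ) * k * n)) * qb n k ^ r * qb (n + k) k ^ r
          = ∑ i ∈ range (n + 1),
            T (-((n : ℤ) * i)) * qb n i * qb (n + i) i * b i) →
      ∀ i : ℕ, b i = ∑ k ∈ range (i + 1), P r k i := by
  have hsum := sum_qb_pow_eq_of_expansion (P r) r (hPsupp r) (hPid r hr)
  have huniq : ∀ b : ℕ → LaurentPolynomial ℤ,
      (∀ n : ℕ, ∑ k ∈ range (n + 1), T (-((r : ℤ) * k * n)) * qb n k ^ r * qb (n + k) k ^ r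
        = ∑ i ∈ range (n + 1), T (-((n : ℤ) * i)) * qb n i * qb (n + i) i * b i) →
      ∀ i : ℕ, b i = ∑ k ∈ range (i + 1), P r k i := by
    intro b hb
    refine eq_of_triangular_sum_eq (fun n i => T (-((n : ℤ) * i)) * qb n i * qb (n + i) i)
      (fun n => ?_) fun n => (hb n).symm.trans (hsum n)
    exact mul_ne_zero (mul_ne_zero (isUnit_T _).ne_zero (qb_ne_zero le_rfl))
      (qb_ne_zero (Nat.le_add_left n n))
  refine ⟨⟨fun i => ∑ k ∈ range (i + 1), P r k i, ⟨fun i m => ?_, hsum⟩,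
    fun b hb => funext (huniq b hb.2)⟩, fun b hb => huniq b hb.2⟩
  exact LaurentPolynomial.coeff_sum_nonneg _ _ _ fun k _ => hPnonneg r k i m
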